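/- Let f be a polynomial in ℝ[x₁,…,xₙ] and let x ∈ 𝒵(f) be an isolated point of H(f). Then for every i ∈ {1,…,n} and every δ > 0 there exists y ∈ ℝⁿ such that ‖y − x‖ < δ, 0 < |f(y)| < δ, ∂f/∂x_j(y) = 0 for every j ∈ {1,…,n} with j ≠ i, and ∂f/∂x_i(y) ≠ 0. In particular, every isolated point of H(f) lies, for each i, in the closure of the set of critical points of the i-th coordinate projection restricted to the level sets {f = e} for e ≠ 0 arbitrarily small. -/

import Mathlib

open MvPolynomial Metric

lemma aux_hasDerivAt {n : ℕ} (p : MvPolynomial (Fin n) ℝ) (y : EuclideanSpace ℝ (Fin n))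
    (i : Fin n) (t : ℝ) :
    HasDerivAt (fun s : ℝ => MvPolynomial.eval (y + s • EuclideanSpace.single i (1:ℝ)) p)
      (MvPolynomial.eval (y + t • EuclideanSpace.single i (1:ℝ)) (pderiv i p)) t := by
  induction p using MvPolynomial.induction_on with
  | C a => simpa using hasDerivAt_const t a
  | add p q hp hq =>
    have h := hp.fun_add hq
    simp only [map_add]
    exact h
  | mul_X p j hp =>
    have hX : HasDerivAt (fun s : ℝ => (y + s • EuclideanSpace.single i (1:ℝ)) j)
        ((Pi.single i (1:ℝ) : Fin n → ℝ) j) t := by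
      by_cases hij : j = i
      · subst hij
        simpa using (hasDerivAt_id' t).const_add (y j)
      · simpa [hij] using hasDerivAt_const t (y j)
    have h := hp.fun_mul hX
    simp only [map_mul, eval_X]
    refine h.congr_deriv ?_
    simp only [Derivation.leibniz, pderiv_X, map_mul, eval_X, map_add, smul_eq_mul]
    by_cases hij : j = i
    · subst hij; simp; ring
    · simp [Pi.single_apply, hij, Ne.symm hij, mul_comm]

lemma aux_cont {n : ℕ} (p : MvPolynomial (Fin n) ℝ) :
    Continuous (fun y : EuclideanSpace ℝ (Fin n) => MvPolynomial.eval y p) :=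
  (MvPolynomial.continuous_eval p).comp (PiLp.continuous_ofLp 2 _)

lemma aux_quad {n : ℕ} (p : MvPolynomial (Fin n) ℝ) (i : Fin n) (K : Set (EuclideanSpace ℝ (Fin n)))
    (hK : Convex ℝ K) (M : ℝ) (hM : ∀ y ∈ K, ‖MvPolynomial.eval y (pderiv i (pderiv i p))‖ ≤ M)
    (y : EuclideanSpace ℝ (Fin n)) (hy : y ∈ K) (t : ℝ)
    (ht : y + t • EuclideanSpace.single i (1:ℝ) ∈ K) (h0 : MvPolynomial.eval y (pderiv i p) = 0) :
    MvPolynomial.eval (y + t • EuclideanSpace.single i (1:ℝ)) p - MvPolynomial.eval y p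
      ≤ M * |t| ^ 2 := by
  have hM0 : 0 ≤ M := (norm_nonneg _).trans (hM y hy)
  have hseg : ∀ s ∈ Set.uIcc 0 t, y + s • EuclideanSpace.single i (1:ℝ) ∈ K ∧ |s| ≤ |t| := by
    intro s hs
    rw [← segment_eq_uIcc, segment_eq_image] at hs
    obtain ⟨θ, ⟨h1, h2⟩, rfl⟩ := hs
    constructor
    · have := hK hy ht (sub_nonneg.2 h2) h1 (by ring)
      convert this using 1
      simp only [smul_add, sub_smul, one_smul, smul_eq_mul, mul_zero, zero_add, mul_smul]
      abel
    · simp [abs_mul, abs_of_nonneg h1]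
      exact mul_le_of_le_one_left (abs_nonneg _) h2
  have e0 : y + (0:ℝ) • EuclideanSpace.single i (1:ℝ) = y := by simp
  have h1 : ∀ s ∈ Set.uIcc 0 t,
      ‖MvPolynomial.eval (y + s • EuclideanSpace.single i (1:ℝ)) (pderiv i p)‖ ≤ M * |t| := by
    intro s hs
    have := (convex_uIcc 0 t).norm_image_sub_le_of_norm_hasDerivWithin_le
      (fun u _ => (aux_hasDerivAt (pderiv i p) y i u).hasDerivWithinAt)
      (fun u hu => hM _ (hseg u hu).1) Set.left_mem_uIcc hs
    simp only [e0, h0, sub_zero] at this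
    refine this.trans ?_
    exact mul_le_mul_of_nonneg_left (hseg s hs).2 hM0
  have := (convex_uIcc 0 t).norm_image_sub_le_of_norm_hasDerivWithin_le
      (fun u _ => (aux_hasDerivAt p y i u).hasDerivWithinAt)
      h1 Set.left_mem_uIcc Set.right_mem_uIcc
  simp only [e0, sub_zero] at this
  refine (le_abs_self _).trans (this.trans (le_of_eq ?_))
  rw [Real.norm_eq_abs]; ring

/-- If `x` is an isolated point of `H(f)`, then for every
coordinate `i` and every `δ > 0` there is a point `y` with `‖y − x‖ < δ`,
`0 < |f(y)| < δ`, all partial derivatives `∂f/∂x_j(y)` with `j ≠ i` vanishing,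
and `∂f/∂x_i(y) ≠ 0`. -/
theorem isolated_mem_closure_critical_points
    (n : ℕ) (hn : 1 ≤ n) (f : MvPolynomial (Fin n) ℝ)
    (H : Set (EuclideanSpace ℝ (Fin n)))
    (hH : H = {y : EuclideanSpace ℝ (Fin n) | MvPolynomial.eval y f = 0})
    (x : EuclideanSpace ℝ (Fin n)) (hx : x ∈ H)
    (hiso : ∃ r > 0, Metric.ball x r ∩ H = {x}) :
    ∀ i : Fin n, ∀ δ > (0 : ℝ), ∃ y : EuclideanSpace ℝ (Fin n),
      ‖y - x‖ < δ ∧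
      0 < |MvPolynomial.eval y f| ∧ |MvPolynomial.eval y f| < δ ∧
      (∀ j : Fin n, j ≠ i → MvPolynomial.eval y (MvPolynomial.pderiv j f) = 0) ∧
      MvPolynomial.eval y (MvPolynomial.pderiv i f) ≠ 0 := by
  intro i δ hδ
  obtain ⟨r, hr, hball⟩ := hiso
  set g : MvPolynomial (Fin n) ℝ := f * f with hg
  set e : EuclideanSpace ℝ (Fin n) := EuclideanSpace.single i (1:ℝ) with he
  have hne : ‖e‖ = 1 := by simp [he]
  have hfx : MvPolynomial.eval x f = 0 := by rw [hH] at hx; exact hx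
  have hgx : MvPolynomial.eval x g = 0 := by simp [hg, hfx]
  have hgc := aux_cont g
  have hpos : ∀ y ∈ ball x r, y ≠ x → 0 < MvPolynomial.eval y g := by
    intro y hy hyx
    have : MvPolynomial.eval y f ≠ 0 := by
      intro h
      have : y ∈ ball x r ∩ H := ⟨hy, by rw [hH]; exact h⟩
      rw [hball] at this
      exact hyx this
    simpa [hg] using mul_self_pos.2 this
  have hsmall : ∀ η > 0, ∃ ε > 0, ∀ t : ℝ, |t| < ε → MvPolynomial.eval (x + t • e) g < η := by
    intro η hη
    have hc : Continuous (fun t : ℝ => MvPolynomial.eval (x + t • e) g) :=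
      hgc.comp (f := fun t : ℝ => x + t • e) (by fun_prop)
    obtain ⟨ε, hε, h⟩ := Metric.continuous_iff.1 hc 0 η hη
    refine ⟨ε, hε, fun t ht => ?_⟩
    have := h t (by simpa using ht)
    simp only [zero_smul, add_zero, hgx, Real.dist_eq, sub_zero] at this
    exact (abs_lt.1 this).2
  set ρ := min (r/2) (δ/2) with hρ
  have hρ0 : 0 < ρ := by positivity
  have hρr : ρ < r := (min_le_left _ _).trans_lt (by linarith)
  have hρδ : ρ < δ := (min_le_right _ _).trans_lt (by linarith)
  obtain ⟨μ, hμ, hann⟩ : ∃ μ > 0, ∀ y ∈ closedBall x ρ \ ball x (ρ/2), μ ≤ MvPolynomial.eval y g := by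
    have hcomp : IsCompact (closedBall x ρ \ ball x (ρ/2)) :=
      (isCompact_closedBall x ρ).diff isOpen_ball
    rcases (closedBall x ρ \ ball x (ρ/2)).eq_empty_or_nonempty with h | h
    · exact ⟨1, one_pos, by simp [h]⟩
    · obtain ⟨z, hz, hmin⟩ := hcomp.exists_isMinOn h hgc.continuousOn
      refine ⟨_, hpos z (closedBall_subset_ball hρr hz.1) ?_, fun y hy => hmin hy⟩
      rintro rfl
      exact hz.2 (mem_ball_self (by positivity))
  obtain ⟨ε₀, hε₀, hε₀'⟩ := hsmall (min μ (δ^2)) (by positivity)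
  set ε := min ε₀ (ρ/2) with hε
  have hεpos : 0 < ε := by positivity
  have hmin : ∀ t : ℝ, ∃ y : EuclideanSpace ℝ (Fin n), t ∈ Set.Ioo 0 ε →
      y ∈ ball x (ρ/2) ∧ y i = x i + t ∧ MvPolynomial.eval y g < δ^2 ∧
      MvPolynomial.eval y g ≤ MvPolynomial.eval (x + t • e) g ∧
      ∀ z ∈ closedBall x ρ, z i = x i + t → MvPolynomial.eval y g ≤ MvPolynomial.eval z g := by
    intro t
    by_cases ht : t ∈ Set.Ioo 0 ε
    swap
    · exact ⟨x, fun h => absurd h ht⟩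
    have hat : |t| < ε := by rw [abs_of_pos ht.1]; exact ht.2
    have hcl : IsClosed {z : EuclideanSpace ℝ (Fin n) | z i = x i + t} :=
      isClosed_eq (by fun_prop) continuous_const
    have hmem : x + t • e ∈ closedBall x ρ ∩ {z : EuclideanSpace ℝ (Fin n) | z i = x i + t} := by
      constructor
      · simp [norm_smul, hne]
        have := hat.trans_le (min_le_right _ _)
        linarith
      · simp [he]
    obtain ⟨y, hy, hym⟩ := ((isCompact_closedBall x ρ).inter_right hcl).exists_isMinOn
      ⟨_, hmem⟩ hgc.continuousOn
    have hle : MvPolynomial.eval y g ≤ MvPolynomial.eval (x + t • e) g := hym hmem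
    have hlt := hle.trans_lt (hε₀' t (hat.trans_le (min_le_left _ _)))
    refine ⟨y, fun _ => ⟨?_, hy.2, hlt.trans_le (min_le_right _ _), hle,
      fun z hz hzi => hym ⟨hz, hzi⟩⟩⟩
    by_contra hyb
    exact absurd (hann y ⟨hy.1, hyb⟩) (not_le.2 (hlt.trans_le (min_le_left _ _)))
  choose Y hY using hmin
  have hsub : ball x (ρ/2) ⊆ closedBall x ρ := fun z hz => by
    simp only [mem_ball, mem_closedBall] at *; linarith
  have hYx : ∀ t ∈ Set.Ioo 0 ε, 0 < MvPolynomial.eval (Y t) g := by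
    intro t ht
    obtain ⟨h1, h2, -⟩ := hY t ht
    refine hpos _ (closedBall_subset_ball hρr (hsub h1)) ?_
    intro h
    rw [h] at h2
    linarith [ht.1]
  have hder : ∀ t ∈ Set.Ioo 0 ε, ∀ j, j ≠ i → MvPolynomial.eval (Y t) (pderiv j g) = 0 := by
    intro t ht j hj
    obtain ⟨h1, h2, -, -, h5⟩ := hY t ht
    have hd := aux_hasDerivAt g (Y t) j 0
    have hloc : IsLocalMin (fun s : ℝ =>
        MvPolynomial.eval (Y t + s • EuclideanSpace.single j (1:ℝ)) g) 0 := by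
      have hc : Continuous (fun s : ℝ => Y t + s • EuclideanSpace.single j (1:ℝ)) := by fun_prop
      have hev := hc.continuousAt.eventually_mem (x := 0)
        (isOpen_ball.mem_nhds (by simpa using h1) : ball x (ρ/2) ∈ _)
      filter_upwards [hev] with s hs
      have := h5 _ (hsub hs) (by simp [h2, hj.symm])
      simpa using this
    have := hloc.hasDerivAt_eq_zero hd
    simpa using this
  have hpd : ∀ (y : EuclideanSpace ℝ (Fin n)) j, MvPolynomial.eval y (pderiv j g)
      = 2 * MvPolynomial.eval y f * MvPolynomial.eval y (pderiv j f) := by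
    intro y j
    simp [hg, Derivation.leibniz]; ring
  by_contra hcon
  have hzero : ∀ t ∈ Set.Ioo 0 ε, MvPolynomial.eval (Y t) (pderiv i g) = 0 := by
    intro t ht
    by_contra hn0
    apply hcon
    obtain ⟨h1, h2, h3, -⟩ := hY t ht
    have hp := hYx t ht
    have hgf : MvPolynomial.eval (Y t) g = MvPolynomial.eval (Y t) f ^ 2 := by simp [hg]; ring
    have hf0 : MvPolynomial.eval (Y t) f ≠ 0 := by
      intro h; rw [hgf, h] at hp; simp at hp
    refine ⟨Y t, ?_, abs_pos.2 hf0, ?_, ?_, ?_⟩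
    · rw [← dist_eq_norm]
      have := mem_ball.1 h1
      linarith
    · rw [hgf] at h3
      exact abs_lt_of_sq_lt_sq h3 hδ.le
    · intro j hj
      have := hder t ht j hj
      rw [hpd] at this
      simpa [hf0] using this
    · intro h
      apply hn0
      rw [hpd, h, mul_zero]
  obtain ⟨M, hM⟩ := (isCompact_closedBall x ρ).exists_bound_of_continuousOn
    (aux_cont (pderiv i (pderiv i g))).continuousOn
  have hq : ∀ t ∈ Set.Ioo 0 ε, ∀ s ∈ Set.Ioo 0 ε,
      MvPolynomial.eval (Y s) g - MvPolynomial.eval (Y t) g ≤ M * |s - t| ^ 2 := by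
    intro t ht s hs
    obtain ⟨h1, h2, -⟩ := hY t ht
    obtain ⟨-, -, -, -, h5⟩ := hY s hs
    have hK : Y t + (s - t) • e ∈ closedBall x ρ := by
      rw [mem_closedBall, dist_eq_norm]
      have a1 : ‖Y t - x‖ < ρ/2 := by rw [← dist_eq_norm]; exact h1
      have a2 : ‖(s - t) • e‖ < ρ/2 := by
        rw [norm_smul, hne, mul_one, Real.norm_eq_abs, abs_lt]
        have : ε ≤ ρ/2 := min_le_right _ _
        constructor <;> linarith [ht.1, ht.2, hs.1, hs.2]
      have : Y t + (s - t) • e - x = (Y t - x) + (s - t) • e := by abel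
      rw [this]
      linarith [norm_add_le (Y t - x) ((s - t) • e)]
    have b1 := h5 _ hK (by simp [he, h2])
    have b2 := aux_quad g i _ (convex_closedBall x ρ) M hM (Y t) (hsub h1) (s - t) hK (hzero t ht)
    linarith
  have hconst : ∀ t ∈ Set.Ioo 0 ε, ∀ s ∈ Set.Ioo 0 ε,
      MvPolynomial.eval (Y s) g = MvPolynomial.eval (Y t) g := by
    have hd : ∀ t ∈ Set.Ioo 0 ε, HasDerivAt (fun s => MvPolynomial.eval (Y s) g) 0 t := by
      intro t ht
      rw [hasDerivAt_iff_isLittleO]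
      have hO : (fun s => MvPolynomial.eval (Y s) g - MvPolynomial.eval (Y t) g - (s - t) • (0:ℝ))
          =O[nhds t] (fun s => ‖s - t‖ ^ 2) := by
        refine Asymptotics.IsBigO.of_bound M ?_
        filter_upwards [isOpen_Ioo.mem_nhds ht] with s hs
        have c1 := hq t ht s hs
        have c2 := hq s hs t ht
        rw [abs_sub_comm] at c2
        simp only [smul_zero, sub_zero, Real.norm_eq_abs, abs_pow, abs_abs]
        rw [abs_le]
        constructor <;> linarith
      refine hO.trans_isLittleO ?_
      exact Asymptotics.isLittleO_pow_sub_sub t one_lt_two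
    intro t ht s hs
    exact isOpen_Ioo.is_const_of_deriv_eq_zero isPreconnected_Ioo
      (fun u hu => (hd u hu).differentiableAt.differentiableWithinAt)
      (fun u hu => (hd u hu).deriv) hs ht
  have ht0 : ε/2 ∈ Set.Ioo 0 ε := ⟨by linarith, by linarith⟩
  obtain ⟨ε₁, hε₁, h₁⟩ := hsmall _ (hYx _ ht0)
  have hmm : 0 < min ε₁ ε := by positivity
  have hs : min ε₁ ε / 2 ∈ Set.Ioo 0 ε := ⟨by linarith, by linarith [min_le_right ε₁ ε]⟩
  have k1 := h₁ (min ε₁ ε / 2) (by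
    rw [abs_of_pos (by linarith)]; linarith [min_le_left ε₁ ε])
  have k2 := (hY _ hs).2.2.2.1
  rw [hconst _ ht0 _ hs] at k2
  linarith
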